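/- Let p be an odd prime. Then 2^{p−1} ≡ 1 + p·((2N_{p−2})_0 − 1) + p^2·((pB_{p−1})_1·(2N_{p−2})_0 − (2N_{p−2})_0^2 + (2N_{p−2})_0 + (2N_{p−2})_1 − 2) (mod p^3). -/

import Mathlib

/-- The number of ascents of a permutation of `Fin n` (positions `i` with `σ i < σ (i+1)`). -/
def numAscents {n : ℕ} (σ : Equiv.Perm (Fin n)) : ℕ :=
  (Finset.univ.filter (fun i : Fin (n - 1) =>
    σ ⟨i.val, by have := i.isLt; omega⟩ < σ ⟨i.val + 1, by have := i.isLt; omega⟩)).card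

/-- The number of permutations of `Fin n` with an even number of ascents. -/
def evenAscentPerms (n : ℕ) : ℕ :=
  (Finset.univ.filter (fun σ : Equiv.Perm (Fin n) => Even (numAscents σ))).card

/-- The Eulerian number `E(n, m)`: permutations of `Fin n` with exactly `m` ascents. -/
def eulerian (n m : ℕ) : ℕ :=
  (Finset.univ.filter (fun σ : Equiv.Perm (Fin n) => numAscents σ = m)).card

/-- `x ≡ 0 (mod p^k)` for a rational `x`: either `x = 0` or the `p`-adic valuation
of `x` is at least `k`. -/
def PadicDvd (p k : ℕ) (x : ℚ) : Prop :=
  x = 0 ∨ (k : ℤ) ≤ padicValRat p x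

/-- The Agoh–Giuga quotient `(p·B_{p-1} + 1)/p`. -/
def agQuot (p : ℕ) : ℚ := ((p : ℚ) * bernoulli (p - 1) + 1) / p

/-- `(2N_{p-2})_0`: the first digit of the base-`p` expansion of `2·N_{p-2}`. -/
def digit0 (p : ℕ) : ℚ := ((2 * evenAscentPerms (p - 2)) % p : ℕ)

/-- `(2N_{p-2})_1`: the second digit of the base-`p` expansion of `2·N_{p-2}`. -/
def digit1 (p : ℕ) : ℚ := ((2 * evenAscentPerms (p - 2) / p) % p : ℕ)

open Equiv Finset

/-- The signed count `∑_σ (-1)^(asc σ)` over the permutations of `Fin n`. -/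
def signedAscentSum (n : ℕ) : ℤ := ∑ σ : Perm (Fin n), (-1) ^ numAscents σ

/-- The signed count `∑_σ (-1)^(asc σ)` over the permutations of `Fin (m + 1)` with `σ 0 = j`. -/
def firstValueSum (m j : ℕ) : ℤ :=
  ∑ σ : Perm (Fin (m + 1)), if (σ 0 : ℕ) = j then (-1) ^ numAscents σ else 0

theorem two_mul_evenAscentPerms (n : ℕ) :
    (2 * evenAscentPerms n : ℤ) = n.factorial + signedAscentSum n := by
  have h : (n.factorial : ℤ) = ∑ σ : Perm (Fin n), (1 : ℤ) := by
    simp [Fintype.card_perm]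
  rw [h, signedAscentSum, ← sum_add_distrib, evenAscentPerms, card_filter, Nat.cast_sum, mul_sum]
  refine sum_congr rfl fun σ _ => ?_
  rcases Nat.even_or_odd (numAscents σ) with h | h
  · simp [h]
  · simp [h.neg_one_pow, Nat.not_even_iff_odd.2 h]

/-- The permutation with first value `j` whose remaining values are ordered like `τ`. -/
def consPerm {n : ℕ} (j : Fin (n + 1)) (τ : Perm (Fin n)) : Perm (Fin (n + 1)) :=
  (Perm.decomposeFin.symm (0, τ)).trans j.cycleRange.symm

@[simp]
theorem consPerm_zero {n : ℕ} (j : Fin (n + 1)) (τ : Perm (Fin n)) : consPerm j τ 0 = j := by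
  simp [consPerm]

@[simp]
theorem consPerm_succ {n : ℕ} (j : Fin (n + 1)) (τ : Perm (Fin n)) (i : Fin n) :
    consPerm j τ i.succ = j.succAbove (τ i) := by
  simp [consPerm]

theorem consPerm_bijective (n : ℕ) :
    Function.Bijective fun x : Fin (n + 1) × Perm (Fin n) => consPerm x.1 x.2 := by
  rw [Fintype.bijective_iff_injective_and_card]
  refine ⟨?_, by simp [Fintype.card_perm, Nat.factorial_succ]⟩
  rintro ⟨j, τ⟩ ⟨k, υ⟩ h
  dsimp only at h
  obtain rfl : j = k := by simpa using DFunLike.congr_fun h 0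
  have hτ : τ = υ := by
    ext1 i
    simpa using DFunLike.congr_fun h i.succ
  rw [hτ]

theorem numAscents_succ {m : ℕ} (σ : Perm (Fin (m + 1))) :
    numAscents σ = ∑ i : Fin m, if σ i.castSucc < σ i.succ then 1 else 0 := by
  rw [numAscents, card_filter]
  rfl

theorem numAscents_consPerm {m : ℕ} (j : Fin (m + 2)) (τ : Perm (Fin (m + 1))) :
    numAscents (consPerm j τ) = (if (j : ℕ) ≤ τ 0 then 1 else 0) + numAscents τ := by
  rw [numAscents_succ, numAscents_succ, Fin.sum_univ_succ]
  congr 1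
  · rw [Fin.castSucc_zero, consPerm_zero, consPerm_succ]
    simp only [Fin.lt_succAbove_iff_le_castSucc, Fin.le_def, Fin.val_castSucc]
  · refine sum_congr rfl fun i _ => ?_
    simp only [← Fin.succ_castSucc, consPerm_succ, Fin.succAbove_lt_succAbove_iff]

theorem firstValueSum_succ {m j : ℕ} (hj : j ≤ m + 1) :
    firstValueSum (m + 1) j =
      ∑ τ : Perm (Fin (m + 1)), (if j ≤ τ 0 then -1 else 1) * (-1) ^ numAscents τ := by
  rw [firstValueSum, ← (consPerm_bijective (m + 1)).sum_comp, Fintype.sum_prod_type,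
    Fintype.sum_eq_single (⟨j, by omega⟩ : Fin (m + 2))]
  · refine sum_congr rfl fun τ _ => ?_
    rw [consPerm_zero, if_pos rfl, numAscents_consPerm, pow_add]
    congr 1
    split_ifs <;> simp
  · intro k hk
    refine sum_eq_zero fun τ _ => ?_
    rw [consPerm_zero, if_neg fun h => hk (Fin.ext h)]

theorem firstValueSum_zero_zero : firstValueSum 0 0 = 1 := by
  decide

theorem firstValueSum_succ_zero (m : ℕ) :
    firstValueSum (m + 1) 0 = -signedAscentSum (m + 1) := by
  simp [firstValueSum_succ, signedAscentSum]

theorem firstValueSum_succ_self (m : ℕ) :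
    firstValueSum (m + 1) (m + 1) = signedAscentSum (m + 1) := by
  rw [firstValueSum_succ le_rfl, signedAscentSum]
  refine sum_congr rfl fun τ _ => ?_
  rw [if_neg (by omega), one_mul]

theorem firstValueSum_self (n : ℕ) : firstValueSum n n = signedAscentSum n := by
  cases n with
  | zero => decide
  | succ m => exact firstValueSum_succ_self m

theorem firstValueSum_zero (n : ℕ) :
    firstValueSum n 0 = (if n = 0 then 2 else 0) - signedAscentSum n := by
  cases n with
  | zero => decide
  | succ m => simp [firstValueSum_succ_zero]

theorem firstValueSum_succ_succ {m j : ℕ} (hj : j ≤ m) :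
    firstValueSum (m + 1) (j + 1) = firstValueSum (m + 1) j + 2 * firstValueSum m j := by
  rw [firstValueSum_succ (by omega), firstValueSum_succ (by omega), firstValueSum, mul_sum,
    ← sum_add_distrib]
  refine sum_congr rfl fun τ _ => ?_
  rcases lt_trichotomy (τ 0 : ℕ) j with h | h | h
  · rw [if_neg (by omega), if_neg (by omega), if_neg (by omega)]; ring
  · rw [if_neg (by omega), if_pos (by omega), if_pos h]; ring
  · rw [if_pos (by omega), if_pos (by omega), if_neg (by omega)]; ring

theorem firstValueSum_eq_sum_choose {m j : ℕ} (hj : j ≤ m) :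
    firstValueSum m j =
      ∑ i ∈ range (j + 1), 2 ^ i * (j.choose i : ℤ) * firstValueSum (m - i) 0 := by
  induction j generalizing m with
  | zero => simp
  | succ j ih =>
    obtain ⟨m, rfl⟩ : ∃ k, m = k + 1 := ⟨m - 1, by omega⟩
    rw [firstValueSum_succ_succ (by omega), ih (by omega), ih (by omega), sum_range_succ' _ (j + 1),
      mul_sum]
    simp only [Nat.choose_succ_succ, Nat.cast_add, mul_add, add_mul, sum_add_distrib,
      Nat.add_sub_add_right]
    rw [add_comm, add_assoc]
    congr 1
    · refine sum_congr rfl fun i _ => ?_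
      ring
    · rw [sum_range_succ', sum_range_succ]
      simp

theorem signedAscentSum_eq_sum_choose (n : ℕ) :
    signedAscentSum n = ∑ x ∈ antidiagonal n,
      2 ^ x.1 * (n.choose x.1 : ℤ) * ((if x.2 = 0 then 2 else 0) - signedAscentSum x.2) := by
  rw [← firstValueSum_self, firstValueSum_eq_sum_choose le_rfl,
    Nat.sum_antidiagonal_eq_sum_range_succ fun a b =>
      2 ^ a * (n.choose a : ℤ) * ((if b = 0 then 2 else 0) - signedAscentSum b)]
  simp only [firstValueSum_zero]

open PowerSeries in
/-- The signed ascent sums are, up to normalization, tangent numbers. -/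
theorem succ_mul_signedAscentSum {n : ℕ} (hn : n ≠ 0) :
    ((n : ℚ) + 1) * signedAscentSum n = (4 ^ (n + 1) - 2 ^ (n + 1)) * bernoulli (n + 1) := by
  set A : ℚ⟦X⟧ := mk fun k => (signedAscentSum k : ℚ) / k.factorial with hA
  set E : ℚ⟦X⟧ := rescale 2 (exp ℚ) with hE
  set β : ℚ⟦X⟧ := bernoulliPowerSeries ℚ with hβ
  have hAE : A = E * (C 2 - A) := by
    ext k
    have hk := congrArg (Int.cast : ℤ → ℚ) (signedAscentSum_eq_sum_choose k)
    push_cast at hk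
    rw [coeff_mul, hA, coeff_mk, hk, sum_div]
    refine sum_congr rfl fun x hx => ?_
    have hx : x.1 + x.2 = k := by simpa using hx
    rw [← hx, Nat.cast_add_choose, hE, coeff_rescale, coeff_exp, map_sub, coeff_C, coeff_mk]
    have h₀ : ((x.1 + x.2).factorial : ℚ) ≠ 0 := by positivity
    have h₁ : (x.1.factorial : ℚ) ≠ 0 := by positivity
    have h₂ : (x.2.factorial : ℚ) ≠ 0 := by positivity
    split_ifs with h
    · simp [h]
      field_simp
    · simp
      field_simp
  have hE4 : rescale 4 (exp ℚ) = E ^ 2 := by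
    rw [hE, ← map_pow, exp_pow_eq_rescale_exp, ← RingHom.comp_apply, ← rescale_mul]
    norm_num
  have hβ2 : rescale 2 β * (E - 1) = C 2 * X := by
    have := congrArg (rescale (2 : ℚ)) (bernoulliPowerSeries_mul_exp_sub_one ℚ)
    simpa [rescale_X] using this
  have hβ4 : rescale 4 β * (E ^ 2 - 1) = C 4 * X := by
    have := congrArg (rescale (4 : ℚ)) (bernoulliPowerSeries_mul_exp_sub_one ℚ)
    simpa [rescale_X, hE4] using this
  have hne : E ^ 2 - 1 ≠ 0 := by
    intro h
    rw [h, mul_zero] at hβ4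
    have := congrArg (coeff 1) hβ4
    simp at this
  have h2 : (C 2 : ℚ⟦X⟧) = 2 := map_ofNat C 2
  have h4 : (C 4 : ℚ⟦X⟧) = 4 := map_ofNat C 4
  rw [h2] at hAE hβ2
  rw [h4] at hβ4
  have key : A * X = C 2 * X + rescale 4 β - rescale 2 β := by
    refine mul_right_cancel₀ hne ?_
    rw [h2]
    linear_combination (X * (E - 1)) * hAE - hβ4 + (E + 1) * hβ2
  have hc := congrArg (coeff (n + 1)) key
  rw [coeff_succ_mul_X, map_sub, map_add, coeff_succ_mul_X, coeff_rescale, coeff_rescale, coeff_C,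
    if_neg hn, hA, coeff_mk, hβ, bernoulliPowerSeries, coeff_mk, Nat.factorial_succ] at hc
  have h₀ : (n.factorial : ℚ) ≠ 0 := by positivity
  simp at hc
  field_simp at hc
  linear_combination hc

/-- The ring of rational numbers whose denominator is prime to `p`. -/
noncomputable def pIntegralRat (p : ℕ) [Fact p.Prime] : Subring ℚ :=
  (PadicInt.subring p).comap (Rat.castHom ℚ_[p])

section pIntegral

variable {p : ℕ} [hp : Fact p.Prime]

theorem mem_pIntegralRat {x : ℚ} : x ∈ pIntegralRat p ↔ padicNorm p x ≤ 1 := by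
  rw [pIntegralRat, Subring.mem_comap, PadicInt.mem_subring_iff, eq_ratCast,
    Padic.eq_padicNorm]
  exact_mod_cast Iff.rfl

theorem inv_natCast_mem_pIntegralRat {k : ℕ} (hk : ¬ p ∣ k) : (k : ℚ)⁻¹ ∈ pIntegralRat p := by
  rw [mem_pIntegralRat, ← one_div, padicNorm.div, padicNorm.one, (padicNorm.nat_eq_one_iff k).2 hk,
    div_one]

theorem padicDvd_pow_mul {k : ℕ} {x : ℚ} (hx : x ∈ pIntegralRat p) :
    PadicDvd p k ((p : ℚ) ^ k * x) := by
  have hp0 : (p : ℚ) ≠ 0 := Nat.cast_ne_zero.2 hp.out.ne_zero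
  rcases eq_or_ne x 0 with rfl | h0
  · exact Or.inl (mul_zero _)
  · right
    have h1 : 0 ≤ padicValRat p x := by
      rw [mem_pIntegralRat, padicNorm.eq_zpow_of_nonzero h0,
        zpow_le_one_iff_right₀ (by exact_mod_cast hp.out.one_lt)] at hx
      omega
    rw [padicValRat.mul (pow_ne_zero _ hp0) h0, padicValRat.pow,
      padicValRat.self hp.out.one_lt]
    omega

theorem bernoulli_mem_pIntegralRat {i : ℕ} (hi : i + 1 < p) : bernoulli i ∈ pIntegralRat p := by
  suffices h : bernoulli' i ∈ pIntegralRat p from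
    mul_mem (pow_mem (neg_mem (one_mem _)) _) h
  induction i using Nat.strong_induction_on with
  | _ i ih =>
    rw [bernoulli'_def]
    refine sub_mem (one_mem _) (sum_mem fun k hk => ?_)
    have hk : k < i := mem_range.1 hk
    have hcast : (i : ℚ) - k + 1 = ((i - k + 1 : ℕ) : ℚ) := by
      push_cast [Nat.cast_sub hk.le]
      rfl
    rw [hcast, div_eq_mul_inv]
    exact mul_mem (mul_mem (natCast_mem _ _) (inv_natCast_mem_pIntegralRat
      (Nat.not_dvd_of_pos_of_lt (by omega) (by omega)))) (ih k hk (by omega))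

theorem sum_range_pow_sub_mul_bernoulli (hodd : Odd p) :
    ∃ s ∈ pIntegralRat p,
      (∑ k ∈ range p, (k : ℚ) ^ (p - 1)) = p * bernoulli (p - 1) + (p : ℚ) ^ 2 * s := by
  have hp0 : (p : ℚ) ≠ 0 := Nat.cast_ne_zero.2 hp.out.ne_zero
  obtain ⟨n, hn⟩ : ∃ n, p = n + 1 := ⟨p - 1, by have := hp.out.pos; omega⟩
  have hn2 : 2 ≤ n := by
    have := hp.out.two_le
    rcases hodd with ⟨r, hr⟩
    omega
  have hcast : (n : ℚ) + 1 = p := by rw [hn]; push_cast; rfl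
  have hn1 : p - 1 = n := by omega
  rw [sum_range_pow, hn1, sum_range_succ, hcast, ← hn]
  refine ⟨(∑ i ∈ range n, bernoulli i * (p.choose i) * (p : ℚ) ^ (p - i) / p) / (p : ℚ) ^ 2,
    ?_, ?_⟩
  · rw [sum_div]
    refine sum_mem fun i hi => ?_
    have hi : i < n := mem_range.1 hi
    have hB : bernoulli i ∈ pIntegralRat p := bernoulli_mem_pIntegralRat (by omega)
    rcases Nat.eq_zero_or_pos i with rfl | hpos
    · have : bernoulli 0 * (p.choose 0) * (p : ℚ) ^ (p - 0) / p / (p : ℚ) ^ 2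
          = (p : ℚ) ^ (n - 2) := by
        rw [show p - 0 = (n - 2) + 3 by omega, pow_add]
        simp
        field_simp
      rw [this]
      exact pow_mem (natCast_mem _ _) _
    · obtain ⟨c, hc⟩ := hp.out.dvd_choose_self hpos.ne' (by omega : i < p)
      have : bernoulli i * (p.choose i) * (p : ℚ) ^ (p - i) / p / (p : ℚ) ^ 2
          = bernoulli i * c * (p : ℚ) ^ (n - i - 1) := by
        rw [show p - i = (n - i - 1) + 2 by omega, pow_add, hc]
        push_cast
        field_simp
      rw [this]
      exact mul_mem (mul_mem hB (natCast_mem _ _)) (pow_mem (natCast_mem _ _) _)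
  · have h1 : p - n = 1 := by omega
    have h2 : p.choose n = p := by rw [hn, Nat.choose_succ_self_right]
    rw [h1, h2]
    field_simp
    ring

end pIntegral

theorem Int.sq_dvd_prod_one_add_mul_sub {ι : Type*} (s : Finset ι) (d : ℤ) (f : ι → ℤ) :
    d ^ 2 ∣ ∏ i ∈ s, (1 + d * f i) - (1 + d * ∑ i ∈ s, f i) := by
  classical
  induction s using Finset.induction_on with
  | empty => simp
  | insert a s ha ih =>
    obtain ⟨c, hc⟩ := ih
    rw [prod_insert ha, sum_insert ha]
    exact ⟨(1 + d * f a) * c + f a * ∑ i ∈ s, f i, by linear_combination (1 + d * f a) * hc⟩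

theorem Int.prime_dvd_factorial_add_one (p : ℕ) [Fact p.Prime] :
    (p : ℤ) ∣ ((p - 1).factorial : ℤ) + 1 := by
  rw [← ZMod.intCast_zmod_eq_zero_iff_dvd]
  push_cast
  rw [ZMod.wilsons_lemma, neg_add_cancel]

/-- Glaisher's congruence: `(p - 1)! + p ≡ ∑ k ^ (p - 1) (mod p ^ 2)`. -/
theorem sq_dvd_factorial_add_sub_sum {p : ℕ} [hp : Fact p.Prime] (hodd : Odd p) :
    (p : ℤ) ^ 2 ∣ (p - 1).factorial + p - ∑ k ∈ range p, (k : ℤ) ^ (p - 1) := by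
  obtain ⟨n, hn⟩ : ∃ n, p = n + 1 := ⟨p - 1, by have := hp.out.pos; omega⟩
  have hn0 : n ≠ 0 := by have := hp.out.two_le; omega
  have heven : Even n := by
    rw [hn] at hodd
    simpa using Nat.Odd.sub_odd hodd odd_one
  have hn1 : p - 1 = n := by omega
  have hcast : (p : ℤ) = n + 1 := by rw [hn]; push_cast; rfl
  obtain ⟨W, hW⟩ := Int.prime_dvd_factorial_add_one p
  rw [hn1] at hW
  have hfermat : ∀ k ∈ range n, ∃ q : ℤ, ((k : ℤ) + 1) ^ n = 1 + p * q := by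
    intro k hk
    have hk : k < n := mem_range.1 hk
    have hcop : IsCoprime ((k + 1 : ℕ) : ℤ) p :=
      Nat.isCoprime_iff_coprime.2
        (Nat.coprime_of_lt_prime (by omega) (by omega) hp.out).symm
    obtain ⟨q, hq⟩ := (Int.ModEq.pow_card_sub_one_eq_one hp.out hcop).symm.dvd
    rw [hn1] at hq
    push_cast at hq
    exact ⟨q, by linear_combination hq⟩
  choose! q hq using hfermat
  have hfact : (n.factorial : ℤ) ^ n = ∏ k ∈ range n, (1 + p * q k) := by
    rw [← prod_range_add_one_eq_factorial, Nat.cast_prod, ← prod_pow]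
    exact prod_congr rfl fun k hk => by rw [← hq k hk]; push_cast; rfl
  have hpow : (n.factorial : ℤ) ^ n = ∏ k ∈ range n, (1 + (p : ℤ) * -W) := by
    rw [prod_const, card_range, ← heven.neg_pow]
    congr 1
    linear_combination -hW
  have hsum : ∑ k ∈ range p, (k : ℤ) ^ n = n + p * ∑ k ∈ range n, q k := by
    rw [hn, sum_range_succ']
    push_cast
    rw [zero_pow hn0, add_zero, sum_congr rfl hq, sum_add_distrib, ← mul_sum, hn]
    simp
  obtain ⟨c, hc⟩ := Int.sq_dvd_prod_one_add_mul_sub (range n) p q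
  obtain ⟨d, hd⟩ := Int.sq_dvd_prod_one_add_mul_sub (range n) p fun _ => -W
  rw [← hfact] at hc
  rw [← hpow, sum_const, card_range, nsmul_eq_mul] at hd
  rw [hn1, hsum]
  exact ⟨W + c - d, by
    have hcast' : (n : ℤ) = p - 1 := by linear_combination -hcast
    rw [hcast'] at hd ⊢
    linear_combination hW + hc - hd⟩

theorem two_pow_p_sub_one_mod_p_cubed
    (p : ℕ) (hp : p.Prime) (hodd : Odd p) :
    PadicDvd p 3 ((2 : ℚ) ^ (p - 1) -
      (1 + (p : ℚ) * (digit0 p - 1) + (p : ℚ) ^ 2 *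
        (agQuot p * digit0 p - (digit0 p) ^ 2 + digit0 p + digit1 p - 2))) := by
  have : Fact p.Prime := ⟨hp⟩
  have hp0 : (p : ℚ) ≠ 0 := Nat.cast_ne_zero.2 hp.ne_zero
  have hp2 := hp.two_le
  obtain ⟨n, hn, hn0⟩ : ∃ n, p = n + 2 ∧ n ≠ 0 :=
    ⟨p - 2, by omega, by rcases hodd with ⟨r, hr⟩; omega⟩
  have hn1 : p - 1 = n + 1 := by omega
  have hn2 : p - 2 = n := by omega
  have hcast : (n : ℚ) = p - 2 := by rw [hn]; push_cast; ring
  obtain ⟨s, hs, hsB⟩ := sum_range_pow_sub_mul_bernoulli (p := p) hodd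
  obtain ⟨t, ht⟩ := sq_dvd_factorial_add_sub_sum (p := p) hodd
  replace ht := congrArg (Int.cast : ℤ → ℚ) ht
  push_cast at ht
  rw [hsB] at ht
  obtain ⟨W, hW⟩ := Int.prime_dvd_factorial_add_one p
  replace hW := congrArg (Int.cast : ℤ → ℚ) hW
  push_cast at hW
  obtain ⟨q, hq⟩ : (p : ℤ) ∣ 2 ^ (p - 1) - 1 := by
    have hcop : IsCoprime (2 : ℤ) p := by
      exact_mod_cast Nat.isCoprime_iff_coprime.2 (Nat.coprime_two_left.2 hodd)
    exact (Int.ModEq.pow_card_sub_one_eq_one hp hcop).symm.dvd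
  replace hq := congrArg (Int.cast : ℤ → ℚ) hq
  push_cast at hq
  set w := agQuot p with hw
  have hwB : (p : ℚ) * w = p * bernoulli (p - 1) + 1 := by
    rw [hw, agQuot]
    field_simp
  have hwmem : w ∈ pIntegralRat p := by
    have : w = W + 1 - p * (t + s) := by
      refine mul_left_cancel₀ hp0 ?_
      linear_combination hwB + hW - ht
    rw [this]
    exact sub_mem (add_mem (intCast_mem _ _) (one_mem _))
      (mul_mem (natCast_mem _ _) (add_mem (intCast_mem _ _) hs))
  set M := 2 * evenAscentPerms (p - 2) with hM
  obtain ⟨d, hd⟩ : ∃ d : ℕ, (M : ℚ) = digit0 p + p * digit1 p + p ^ 2 * d := by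
    refine ⟨M / p / p, ?_⟩
    rw [digit0, digit1, ← hM]
    have h1 := Nat.mod_add_div M p
    have h2 := Nat.mod_add_div (M / p) p
    have h : M = M % p + p * (M / p % p) + p ^ 2 * (M / p / p) := by
      calc M = M % p + p * (M / p % p + p * (M / p / p)) := by rw [h2, h1]
        _ = _ := by ring
    exact_mod_cast h
  have hd0 : digit0 p ∈ pIntegralRat p := natCast_mem _ _
  have hd1 : digit1 p ∈ pIntegralRat p := natCast_mem _ _
  set a := digit0 p
  set b := digit1 p
  have hMsum : (M : ℚ) = n.factorial + signedAscentSum n := by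
    have := two_mul_evenAscentPerms n
    rw [hM, hn2]
    exact_mod_cast congrArg (Int.cast : ℤ → ℚ) this
  have hT := succ_mul_signedAscentSum hn0
  rw [← hn1, show (4 : ℚ) = 2 ^ 2 by norm_num, ← pow_mul, mul_comm 2, pow_mul,
    show (2 : ℚ) ^ (p - 1) = 1 + p * q by linear_combination hq, hcast] at hT
  have hf : ((p - 1).factorial : ℚ) = (p - 1) * n.factorial := by
    rw [hn1, Nat.factorial_succ]
    push_cast
    rw [hcast]
    ring
  rw [hf] at ht
  have hpM : (p - 1) * (M : ℚ)
      = p * w - 1 - p + p ^ 2 * (t + s) + (1 + p * q) * q * (p * w - 1) := by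
    linear_combination (p - 1) * hMsum + hT + ht - (1 + (1 + p * q) * q) * hwB
  set e : ℚ := M - b - p * d - w + 1 - p * (t + s) - q * w - q ^ 2 * (p * w - 1) with he
  have hae : a = 1 + q + p * e := by
    linear_combination -hpM - hd
  have hpm : (p : ℚ) ∈ pIntegralRat p := natCast_mem _ _
  have hdm : (d : ℚ) ∈ pIntegralRat p := natCast_mem _ _
  have hMm : (M : ℚ) ∈ pIntegralRat p := natCast_mem _ _
  have hqm : (q : ℚ) ∈ pIntegralRat p := intCast_mem _ _
  have hts : (t + s : ℚ) ∈ pIntegralRat p := add_mem (intCast_mem _ _) hs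
  have hpdm : (p * d : ℚ) ∈ pIntegralRat p := mul_mem hpm hdm
  have hem : e ∈ pIntegralRat p :=
    sub_mem (sub_mem (sub_mem (add_mem (sub_mem (sub_mem (sub_mem hMm hd1) hpdm) hwmem)
      (one_mem _)) (mul_mem hpm hts)) (mul_mem hqm hwmem))
      (mul_mem (pow_mem hqm _) (sub_mem (mul_mem hpm hwmem) (one_mem _)))
  have hr : d - b - p * d + (t + s) + q ^ 2 * w - w * e + 2 * (e * (a - 1)) - p * e ^ 2 ∈
      pIntegralRat p :=
    sub_mem (add_mem (sub_mem (add_mem (add_mem (sub_mem (sub_mem hdm hd1) hpdm) hts)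
      (mul_mem (pow_mem hqm _) hwmem)) (mul_mem hwmem hem))
      (mul_mem (ofNat_mem _ 2) (mul_mem hem (sub_mem hd0 (one_mem _)))))
      (mul_mem hpm (pow_mem hem _))
  convert padicDvd_pow_mul (k := 3) hr using 1
  have hY : e + w * a - a ^ 2 + a + b - 2 = -(p * (d - b - p * d + (t + s) + q ^ 2 * w - w * e
      + 2 * (e * (a - 1)) - p * e ^ 2)) := by
    linear_combination he + hd + (w - (a - 1 - p * e + q)) * hae
  linear_combination hq - p * hae - p ^ 2 * hY
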